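/- Let f : ℝⁿ → ℝ, g : ℝⁿ → ℝᵐ and h : ℝⁿ → ℝᵖ be continuously differentiable, let δ > 0, let x⁰ ∈ ℝⁿ, and let x : (0, δ) → ℝⁿ satisfy lim_{ε→0⁺} x(ε) = x⁰. Suppose that for every ε ∈ (0, δ) the point x(ε) is stationary for the penalty function f(x) + (1/(2ε))‖max{0, g(x)}‖² + (1/(2ε))‖h(x)‖², i.e. ∇f(x(ε)) + (1/ε) ∑_{i=1}^{m} max{0, g_i(x(ε))} ∇g_i(x(ε)) + (1/ε) ∑_{j=1}^{p} h_j(x(ε)) ∇h_j(x(ε)) = 0, and suppose that the set of vectors {∇g_i(x⁰) : i with g_i(x⁰) ≥ 0} ∪ {∇h_j(x⁰) : j = 1, …, p} is linearly independent. Then g_i(x⁰) ≤ 0 for all i = 1, …, m and h_j(x⁰) = 0 for all j = 1, …, p, i.e. x⁰ is feasible for the problem min f(x) subject to g(x) ≤ 0, h(x) = 0. -/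

import Mathlib

open Filter Set

/-- The gradient of a `C¹` function is continuous. -/
theorem ContDiff.continuous_gradient_of_one {E : Type*} [NormedAddCommGroup E]
    [InnerProductSpace ℝ E] [CompleteSpace E] {f : E → ℝ} (hf : ContDiff ℝ 1 f) :
    Continuous (gradient f) :=
  (InnerProductSpace.toDual ℝ E).symm.continuous.comp (hf.continuous_fderiv one_ne_zero)

/-- Feasibility part of the exact-penalty theorem (general constraints):
stationary points of the penalty `f + (1/(2ε))‖max{0,g}‖² + (1/(2ε))‖h‖²`
converging to `x0` as `ε → 0⁺`, together with the Modified LICQ at `x0`,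
force `g(x0) ≤ 0` and `h(x0) = 0`. -/
theorem penalty_general_feasibility {n m p : ℕ}
    (f : EuclideanSpace ℝ (Fin n) → ℝ)
    (g : Fin m → EuclideanSpace ℝ (Fin n) → ℝ)
    (h : Fin p → EuclideanSpace ℝ (Fin n) → ℝ)
    (hf : ContDiff ℝ 1 f) (hg : ∀ i, ContDiff ℝ 1 (g i))
    (hh : ∀ j, ContDiff ℝ 1 (h j))
    (δ : ℝ) (hδ : 0 < δ)
    (x0 : EuclideanSpace ℝ (Fin n))
    (x : ℝ → EuclideanSpace ℝ (Fin n))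
    (hlim : Tendsto x (nhdsWithin 0 (Set.Ioi 0)) (nhds x0))
    (hstat : ∀ ε ∈ Set.Ioo (0 : ℝ) δ,
      gradient f (x ε) +
        (1 / ε) • ∑ i, (max 0 (g i (x ε))) • gradient (g i) (x ε) +
        (1 / ε) • ∑ j, (h j (x ε)) • gradient (h j) (x ε) = 0)
    (hMLICQ : LinearIndependent ℝ
      (Sum.elim (fun i : {i : Fin m // 0 ≤ g i x0} => gradient (g i.1) x0)
        (fun j : Fin p => gradient (h j) x0))) :
    (∀ i, g i x0 ≤ 0) ∧ (∀ j, h j x0 = 0) := by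
  set F : EuclideanSpace ℝ (Fin n) → EuclideanSpace ℝ (Fin n) := fun y =>
    ∑ i, max 0 (g i y) • gradient (g i) y + ∑ j, h j y • gradient (h j) y with hF
  have hFcont : Continuous F := by
    have hg' := fun i => (hg i).continuous
    have hh' := fun j => (hh j).continuous
    have hGg := fun i => (hg i).continuous_gradient_of_one
    have hGh := fun j => (hh j).continuous_gradient_of_one
    exact (continuous_finsetSum _ fun i _ => (continuous_const.max (hg' i)).smul (hGg i)).add
      (continuous_finsetSum _ fun j _ => (hh' j).smul (hGh j))
  have hscaled : ∀ ε ∈ Set.Ioo (0 : ℝ) δ, ε • gradient f (x ε) + F (x ε) = 0 := by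
    intro ε hε
    have hs := congrArg (ε • ·) (hstat ε hε)
    simpa only [hF, smul_add, smul_smul, mul_one_div_cancel hε.1.ne', one_smul, smul_zero,
      add_assoc] using hs
  have hlimit : Tendsto (fun ε => ε • gradient f (x ε) + F (x ε))
      (nhdsWithin 0 (Set.Ioi 0)) (nhds ((0 : ℝ) • gradient f x0 + F x0)) :=
    ((tendsto_nhdsWithin_of_tendsto_nhds tendsto_id).smul
      ((hf.continuous_gradient_of_one.tendsto x0).comp hlim)).add
      ((hFcont.tendsto x0).comp hlim)
  have hF0 : F x0 = 0 := by
    have hev : (fun ε => ε • gradient f (x ε) + F (x ε)) =ᶠ[nhdsWithin 0 (Set.Ioi 0)]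
        fun _ => 0 := by
      filter_upwards [Ioo_mem_nhdsGT hδ] with ε hε using hscaled ε hε
    simpa using tendsto_nhds_unique hlimit (tendsto_const_nhds.congr' hev.symm)
  have hactive : ∑ i : {i : Fin m // 0 ≤ g i x0}, max 0 (g i x0) • gradient (g i) x0 =
      ∑ i, max 0 (g i x0) • gradient (g i) x0 := by
    rw [← Finset.sum_subtype (Finset.univ.filter fun i => 0 ≤ g i x0) (by simp)
      fun i => max 0 (g i x0) • gradient (g i) x0]
    refine Finset.sum_filter_of_ne fun i _ hne => ?_
    by_contra! hi
    exact hne (by rw [max_eq_left hi.le, zero_smul])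
  have hcoeff := Fintype.linearIndependent_iff.mp hMLICQ
    (Sum.elim (fun i => max 0 (g i.1 x0)) fun j => h j x0)
    (by simpa only [Fintype.sum_sum_type, Sum.elim_inl, Sum.elim_inr, hactive] using hF0)
  refine ⟨fun i => ?_, fun j => hcoeff (Sum.inr j)⟩
  by_contra! hi
  exact (max_eq_left_iff.mp (hcoeff (Sum.inl ⟨i, hi.le⟩))).not_gt hi
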